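/- Let u : ℝ² → ℝ be three times continuously differentiable and let ψ : ℝ² → ℝ be continuously differentiable with compact support. Then ∫_{ℝ²} det(D²u) ψ dx = −(1/2) ∫_{ℝ²} (cof(D²u) ∇u) · ∇ψ dx. -/

import Mathlib

open MeasureTheory

/-- The partial derivative of `f : ℝ² → ℝ` in the `i`-th coordinate direction. -/
noncomputable def pd (i : Fin 2) (f : EuclideanSpace ℝ (Fin 2) → ℝ)
    (x : EuclideanSpace ℝ (Fin 2)) : ℝ :=
  fderiv ℝ f x (EuclideanSpace.single i 1)

/-- The Hessian matrix of `u : ℝ² → ℝ` at `x`. -/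
noncomputable def hessian (u : EuclideanSpace ℝ (Fin 2) → ℝ)
    (x : EuclideanSpace ℝ (Fin 2)) : Matrix (Fin 2) (Fin 2) ℝ :=
  Matrix.of fun i j => pd i (pd j u) x

theorem contDiff_pd {f : EuclideanSpace ℝ (Fin 2) → ℝ} {n m : WithTop ℕ∞} (hf : ContDiff ℝ n f)
    (hmn : m + 1 ≤ n) (i : Fin 2) : ContDiff ℝ m (pd i f) :=
  (hf.fderiv_right hmn).clm_apply contDiff_const

theorem pd_mul {f g : EuclideanSpace ℝ (Fin 2) → ℝ} {x : EuclideanSpace ℝ (Fin 2)}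
    (hf : DifferentiableAt ℝ f x) (hg : DifferentiableAt ℝ g x) (i : Fin 2) :
    pd i (fun y => f y * g y) x = pd i f x * g x + f x * pd i g x := by
  simp [pd, fderiv_fun_mul hf hg]
  ring

theorem pd_add {f g : EuclideanSpace ℝ (Fin 2) → ℝ} {x : EuclideanSpace ℝ (Fin 2)}
    (hf : DifferentiableAt ℝ f x) (hg : DifferentiableAt ℝ g x) (i : Fin 2) :
    pd i (fun y => f y + g y) x = pd i f x + pd i g x := by
  simp [pd, fderiv_fun_add hf hg]

theorem pd_sub {f g : EuclideanSpace ℝ (Fin 2) → ℝ} {x : EuclideanSpace ℝ (Fin 2)}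
    (hf : DifferentiableAt ℝ f x) (hg : DifferentiableAt ℝ g x) (i : Fin 2) :
    pd i (fun y => f y - g y) x = pd i f x - pd i g x := by
  simp [pd, fderiv_fun_sub hf hg]

theorem pd_neg (f : EuclideanSpace ℝ (Fin 2) → ℝ) (x : EuclideanSpace ℝ (Fin 2)) (i : Fin 2) :
    pd i (fun y => -f y) x = -pd i f x := by
  simp [pd, fderiv_fun_neg]

theorem pd_comm {f : EuclideanSpace ℝ (Fin 2) → ℝ} (hf : ContDiff ℝ 2 f) (i j : Fin 2) :
    pd i (pd j f) = pd j (pd i f) := by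
  have pd_pd (k l : Fin 2) (x : EuclideanSpace ℝ (Fin 2)) : pd k (pd l f) x =
      fderiv ℝ (fderiv ℝ f) x (EuclideanSpace.single k 1) (EuclideanSpace.single l 1) := by
    have hd : DifferentiableAt ℝ (fderiv ℝ f) x :=
      (hf.fderiv_right (m := 1) (by norm_num)).differentiable (by norm_num) x
    change fderiv ℝ (fun y => fderiv ℝ f y (EuclideanSpace.single l 1)) x _ = _
    simp [fderiv_clm_apply hd (differentiableAt_const _)]
  funext x
  rw [pd_pd, pd_pd]
  exact (hf.contDiffAt.isSymmSndFDerivAt (by simp)).eq _ _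

theorem hasCompactSupport_pd {f : EuclideanSpace ℝ (Fin 2) → ℝ} (hf : HasCompactSupport f)
    (i : Fin 2) : HasCompactSupport (pd i f) :=
  hf.fderiv_apply ℝ _

theorem integrable_mul_pd {f ψ : EuclideanSpace ℝ (Fin 2) → ℝ} (hf : Continuous f)
    (hψ : ContDiff ℝ 1 ψ) (hψc : HasCompactSupport ψ) (i : Fin 2) :
    Integrable (fun x => f x * pd i ψ x) :=
  (hf.mul (contDiff_pd (m := 0) hψ (by norm_num) i).continuous).integrable_of_hasCompactSupport
    (hasCompactSupport_pd hψc i).mul_left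

theorem integrable_pd_mul {f ψ : EuclideanSpace ℝ (Fin 2) → ℝ} (hf : ContDiff ℝ 1 f)
    (hψ : Continuous ψ) (hψc : HasCompactSupport ψ) (i : Fin 2) :
    Integrable (fun x => pd i f x * ψ x) :=
  ((contDiff_pd (m := 0) hf (by norm_num) i).continuous.mul hψ).integrable_of_hasCompactSupport
    hψc.mul_left

theorem integral_mul_pd {f ψ : EuclideanSpace ℝ (Fin 2) → ℝ} (hf : ContDiff ℝ 1 f)
    (hψ : ContDiff ℝ 1 ψ) (hψc : HasCompactSupport ψ) (i : Fin 2) :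
    ∫ x, f x * pd i ψ x = -∫ x, pd i f x * ψ x :=
  integral_mul_fderiv_eq_neg_fderiv_mul_of_integrable
    (integrable_pd_mul hf hψ.continuous hψc i) (integrable_mul_pd hf.continuous hψ hψc i)
    ((hf.continuous.mul hψ.continuous).integrable_of_hasCompactSupport hψc.mul_left)
    (fun x _ => hf.differentiable (by norm_num) x) (fun x _ => hψ.differentiable (by norm_num) x)

/-- The divergence of `cof(D²u)∇u` is twice the Hessian determinant of `u`. -/
theorem div_cof_hessian_grad {u : EuclideanSpace ℝ (Fin 2) → ℝ} (hu : ContDiff ℝ 3 u)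
    (x : EuclideanSpace ℝ (Fin 2)) :
    pd 0 (fun y => pd 1 (pd 1 u) y * pd 0 u y - pd 0 (pd 1 u) y * pd 1 u y) x +
      pd 1 (fun y => -(pd 0 (pd 1 u) y) * pd 0 u y + pd 0 (pd 0 u) y * pd 1 u y) x =
    2 * (hessian u x).det := by
  have h₁ (i : Fin 2) : ContDiff ℝ 2 (pd i u) := contDiff_pd hu (by norm_num) i
  have d₁ (i : Fin 2) : DifferentiableAt ℝ (pd i u) x := (h₁ i).differentiable (by norm_num) x
  have d₂ (i j : Fin 2) : DifferentiableAt ℝ (pd i (pd j u)) x :=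
    (contDiff_pd (m := 1) (h₁ j) (by norm_num) i).differentiable (by norm_num) x
  have hc : pd 1 (pd 0 u) = pd 0 (pd 1 u) := pd_comm (hu.of_le (by norm_num)) 1 0
  have hc₀ : pd 1 (pd 0 (pd 0 u)) = pd 0 (pd 0 (pd 1 u)) := by rw [pd_comm (h₁ 0), hc]
  rw [pd_sub ((d₂ 1 1).fun_mul (d₁ 0)) ((d₂ 0 1).fun_mul (d₁ 1)),
    pd_add ((d₂ 0 1).fun_neg.fun_mul (d₁ 0)) ((d₂ 0 0).fun_mul (d₁ 1)),
    pd_mul (d₂ 1 1) (d₁ 0), pd_mul (d₂ 0 1) (d₁ 1), pd_mul (d₂ 0 1).fun_neg (d₁ 0),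
    pd_mul (d₂ 0 0) (d₁ 1), pd_neg, hc₀, pd_comm (h₁ 1) 1 0, hc, Matrix.det_fin_two]
  simp only [hessian, Matrix.of_apply, hc]
  ring

/-- For `u : ℝ² → ℝ` of class `C³` and `ψ : ℝ² → ℝ` of class `C¹` with compact support,
`∫ det(D²u) ψ dx = −(1/2) ∫ (cof(D²u)∇u) · ∇ψ dx`, where `cof(D²u)` has rows
`(u₂₂, −u₁₂)` and `(−u₁₂, u₁₁)`. -/
theorem integral_det_hessian_mul_eq_neg_half_integral_cof_grad_inner
    (u ψ : EuclideanSpace ℝ (Fin 2) → ℝ)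
    (hu : ContDiff ℝ 3 u) (hψ : ContDiff ℝ 1 ψ) (hψc : HasCompactSupport ψ) :
    ∫ x, (hessian u x).det * ψ x =
      -(1 / 2) * ∫ x,
        ((pd 1 (pd 1 u) x * pd 0 u x - pd 0 (pd 1 u) x * pd 1 u x) * pd 0 ψ x +
         (-(pd 0 (pd 1 u) x) * pd 0 u x + pd 0 (pd 0 u) x * pd 1 u x) * pd 1 ψ x) := by
  have h₁ (i : Fin 2) : ContDiff ℝ 1 (pd i u) := contDiff_pd hu (by norm_num) i
  have h₂ (i j : Fin 2) : ContDiff ℝ 1 (pd i (pd j u)) :=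
    contDiff_pd (contDiff_pd (m := 2) hu (by norm_num) j) (by norm_num) i
  have hF := ((h₂ 1 1).mul (h₁ 0)).sub ((h₂ 0 1).mul (h₁ 1))
  have hG := ((h₂ 0 1).neg.mul (h₁ 0)).add ((h₂ 0 0).mul (h₁ 1))
  rw [integral_add (integrable_mul_pd hF.continuous hψ hψc 0)
      (integrable_mul_pd hG.continuous hψ hψc 1),
    integral_mul_pd hF hψ hψc, integral_mul_pd hG hψ hψc, ← neg_add,
    ← integral_add (integrable_pd_mul hF hψ.continuous hψc 0)
      (integrable_pd_mul hG hψ.continuous hψc 1)]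
  simp only [← add_mul, div_cof_hessian_grad hu, mul_assoc, integral_const_mul]
  ring
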